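/- arXiv:2212.07732 — 3 statements merged into one kernel-verified Lean document; each statement's English description precedes it below -/
import Mathlib

section
/- Let G be a unicyclic graph and let u be a vertex on the cycle of G to which two paths P_l and P_m are attached, of lengths l ≥ 3 and m ≥ 2 respectively (all internal vertices of the attached paths having degree 2 in G). Let v_l be the pendant end-vertex of P_l, with v_{l-1} its neighbor on P_l, and let u_m be the pendant end-vertex of P_m. Let G* be the graph obtained from G by deleting the edge v_l v_{l-1} and adding the edge u_m v_l. Then SO(G*) = SO(G). -/
open SimpleGraph

/-- The Sombor index of a finite simple graph:
`SO(G) = Σ_{uv ∈ E(G)} √(d(u)² + d(v)²)`. -/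
noncomputable def somborIndex {V : Type*} [Fintype V] (G : SimpleGraph V) : ℝ :=
  letI := Classical.decEq V
  letI : DecidableRel G.Adj := Classical.decRel _
  ∑ e ∈ G.edgeFinset,
    Sym2.lift ⟨fun a b => Real.sqrt ((G.degree a : ℝ) ^ 2 + (G.degree b : ℝ) ^ 2),
      fun a b => by simp [add_comm]⟩ e

/-- A unicyclic graph: a connected graph whose number of edges equals its
number of vertices (equivalently, a connected graph with exactly one cycle). -/
def Unicyclic {V : Type*} [Fintype V] (G : SimpleGraph V) : Prop :=
  letI := Classical.decEq V
  letI : DecidableRel G.Adj := Classical.decRel _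
  G.Connected ∧ G.edgeFinset.card = Fintype.card V

/-- Edge weight for a given degree function. -/
noncomputable def edgeWt {V : Type*} (f : V → ℕ) : Sym2 V → ℝ :=
  Sym2.lift ⟨fun a b => Real.sqrt ((f a : ℝ) ^ 2 + (f b : ℝ) ^ 2),
    fun a b => by simp [add_comm]⟩

lemma edgeWt_mk {V : Type*} (f : V → ℕ) (a b : V) :
    edgeWt f s(a, b) = Real.sqrt ((f a : ℝ) ^ 2 + (f b : ℝ) ^ 2) := rfl

lemma degree_eq_ncard {V : Type*} [Fintype V] (G : SimpleGraph V) (x : V)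
    [Fintype (G.neighborSet x)] : G.degree x = (G.neighborSet x).ncard := by
  rw [Set.ncard_eq_toFinset_card', ← G.card_neighborFinset_eq_degree]
  rfl

lemma sombor_eq {V : Type*} [Fintype V] (G : SimpleGraph V) (S : Finset (Sym2 V))
    (hS : ∀ e, e ∈ S ↔ e ∈ G.edgeSet) :
    somborIndex G = ∑ e ∈ S, edgeWt (fun x => (G.neighborSet x).ncard) e := by
  classical
  unfold somborIndex
  apply Finset.sum_congr
  · ext e
    simp [hS]
  · intro e _
    induction e using Sym2.ind with
    | _ x y => simp only [edgeWt_mk, Sym2.lift_mk, degree_eq_ncard]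

lemma sombor_core {V : Type*} [Fintype V] (G G' : SimpleGraph V) (a b c d e : V)
    (hab : a ≠ b) (hac : a ≠ c) (had : a ≠ d) (hbc : b ≠ c) (hbd : b ≠ d)
    (hbe : b ≠ e) (hcd : c ≠ d) (hce : c ≠ e) (hde : d ≠ e)
    (hb : G.neighborSet b = {a, c}) (hc : G.neighborSet c = {b})
    (hd : G.neighborSet d = {e})
    (ha2 : (G.neighborSet a).ncard = 2) (he2 : (G.neighborSet e).ncard = 2)
    (hG' : G'.edgeSet = (G.edgeSet \ {s(b, c)}) ∪ {s(d, c)}) :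
    somborIndex G' = somborIndex G := by
  classical
  have adj' : ∀ x y, G'.Adj x y ↔ (G.Adj x y ∧ s(x, y) ≠ s(b, c)) ∨ s(x, y) = s(d, c) := by
    intro x y
    rw [← SimpleGraph.mem_edgeSet, hG']
    simp only [Set.mem_union, Set.mem_diff, Set.mem_singleton_iff, SimpleGraph.mem_edgeSet, ne_eq]
  have adjb : ∀ y, G.Adj b y ↔ y = a ∨ y = c := fun y => by
    have := Set.ext_iff.1 hb y
    simpa using this
  have adjc : ∀ y, G.Adj c y ↔ y = b := fun y => by
    have := Set.ext_iff.1 hc y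
    simpa using this
  have adjd : ∀ y, G.Adj d y ↔ y = e := fun y => by
    have := Set.ext_iff.1 hd y
    simpa using this
  have nb' : G'.neighborSet b = {a} := by
    ext y
    simp only [SimpleGraph.mem_neighborSet, adj', adjb, Set.mem_singleton_iff, Sym2.eq_iff, ne_eq]
    grind
  have nc' : G'.neighborSet c = {d} := by
    ext y
    simp only [SimpleGraph.mem_neighborSet, adj', adjc, Set.mem_singleton_iff, Sym2.eq_iff, ne_eq]
    grind
  have nd' : G'.neighborSet d = {e, c} := by
    ext y
    simp only [SimpleGraph.mem_neighborSet, adj', adjd, Set.mem_singleton_iff,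
      Set.mem_insert_iff, Sym2.eq_iff, ne_eq]
    grind
  have nx' : ∀ x, x ≠ b → x ≠ c → x ≠ d → G'.neighborSet x = G.neighborSet x := by
    intro x h1 h2 h3
    ext y
    simp only [SimpleGraph.mem_neighborSet, adj', Sym2.eq_iff, ne_eq]
    grind
  set f := fun x => (G.neighborSet x).ncard with hf
  set f' := fun x => (G'.neighborSet x).ncard with hf'
  have fa : f a = 2 := ha2
  have fe : f e = 2 := he2
  have fb : f b = 2 := by simp only [hf, hb]; exact Set.ncard_pair hac
  have fc : f c = 1 := by simp only [hf, hc]; exact Set.ncard_singleton _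
  have fd : f d = 1 := by simp only [hf, hd]; exact Set.ncard_singleton _
  have fb' : f' b = 1 := by simp only [hf', nb']; exact Set.ncard_singleton _
  have fc' : f' c = 1 := by simp only [hf', nc']; exact Set.ncard_singleton _
  have fd' : f' d = 2 := by simp only [hf', nd']; exact Set.ncard_pair hce.symm
  have fx' : ∀ x, x ≠ b → x ≠ c → x ≠ d → f' x = f x := by
    intro x h1 h2 h3
    simp only [hf, hf', nx' x h1 h2 h3]
  have fa' : f' a = 2 := by rw [fx' a hab hac had, fa]
  have fe' : f' e = 2 := by rw [fx' e hbe.symm hce.symm hde.symm, fe]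
  let R : Finset (Sym2 V) := G.edgeFinset.filter (fun z => b ∉ z ∧ c ∉ z ∧ d ∉ z)
  have h1 : ∀ z, z ∈ insert s(a, b) (insert s(e, d) (insert s(b, c) R)) ↔ z ∈ G.edgeSet := by
    intro z
    induction z using Sym2.ind with
    | _ x y =>
      have s1 := G.adj_comm x y
      simp only [R, Finset.mem_insert, Finset.mem_filter, SimpleGraph.mem_edgeFinset,
        SimpleGraph.mem_edgeSet, Sym2.eq_iff, Sym2.mem_iff]
      clear * - hab hac had hbc hbd hbe hcd hce hde adjb adjc adjd s1
      by_cases xb : x = b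
      · subst xb; grind
      by_cases yb : y = b
      · subst yb; grind
      by_cases xc : x = c
      · subst xc; grind
      by_cases yc : y = c
      · subst yc; grind
      by_cases xd : x = d
      · subst xd; grind
      by_cases yd : y = d
      · subst yd; grind
      grind
  have h2 : ∀ z, z ∈ insert s(a, b) (insert s(e, d) (insert s(d, c) R)) ↔ z ∈ G'.edgeSet := by
    intro z
    rw [hG', Set.mem_union, Set.mem_diff, ← h1]
    simp only [R, Finset.mem_insert, Finset.mem_filter, Set.mem_singleton_iff]
    have e1 : s(a, b) ≠ s(b, c) := by simp [Sym2.eq_iff]; grind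
    have e2 : s(e, d) ≠ s(b, c) := by simp [Sym2.eq_iff]; grind
    have e3 : b ∈ s(b, c) := by simp
    grind
  have n1 : s(a, b) ∉ insert s(e, d) (insert s(b, c) R) := by
    simp only [R, Finset.mem_insert, Finset.mem_filter, Sym2.eq_iff, Sym2.mem_iff]; grind
  have n2 : s(e, d) ∉ insert s(b, c) R := by
    simp only [R, Finset.mem_insert, Finset.mem_filter, Sym2.eq_iff, Sym2.mem_iff]; grind
  have n3 : s(b, c) ∉ R := by
    simp [R]
  have m1 : s(a, b) ∉ insert s(e, d) (insert s(d, c) R) := by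
    simp only [R, Finset.mem_insert, Finset.mem_filter, Sym2.eq_iff, Sym2.mem_iff]; grind
  have m2 : s(e, d) ∉ insert s(d, c) R := by
    simp only [R, Finset.mem_insert, Finset.mem_filter, Sym2.eq_iff, Sym2.mem_iff]; grind
  have m3 : s(d, c) ∉ R := by
    simp [R]
  rw [sombor_eq G' _ h2, sombor_eq G _ h1, Finset.sum_insert n1, Finset.sum_insert n2,
    Finset.sum_insert n3, Finset.sum_insert m1, Finset.sum_insert m2, Finset.sum_insert m3]
  have hR : ∑ z ∈ R, edgeWt f' z = ∑ z ∈ R, edgeWt f z := by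
    apply Finset.sum_congr rfl
    intro z hz
    induction z using Sym2.ind with
    | _ x y =>
      simp only [R, Finset.mem_filter, Sym2.mem_iff, not_or] at hz
      obtain ⟨-, hzb, hzc, hzd⟩ := hz
      rw [edgeWt_mk, edgeWt_mk, fx' x (Ne.symm hzb.1) (Ne.symm hzc.1) (Ne.symm hzd.1),
        fx' y (Ne.symm hzb.2) (Ne.symm hzc.2) (Ne.symm hzd.2)]
  change edgeWt f' _ + (edgeWt f' _ + (edgeWt f' _ + ∑ z ∈ R, edgeWt f' z)) =
    edgeWt f _ + (edgeWt f _ + (edgeWt f _ + ∑ z ∈ R, edgeWt f z))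
  rw [hR]
  simp only [edgeWt_mk, fa, fb, fc, fd, fe, fa', fb', fc', fd', fe']
  ring

/-- Lemma 3.1: in a unicyclic graph with two paths `P_l` (of length `l ≥ 3`) and
`P_m` (of length `m ≥ 2`) attached to a single vertex `u` of the cycle, deleting
the last edge of `P_l` and re-attaching the lost pendant vertex to the end of
`P_m` does not change the Sombor index. -/
theorem sombor_move_pendant_eq {V : Type*} [Fintype V]
    (G : SimpleGraph V) [DecidableRel G.Adj] (hG : Unicyclic G)
    (u : V) (hcyc : ∃ c : G.Walk u u, c.IsCycle)
    (l m : ℕ) (hl : 3 ≤ l) (hm : 2 ≤ m)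
    (P : ℕ → V) (hP0 : P 0 = u)
    (hPadj : ∀ i < l, G.Adj (P i) (P (i + 1)))
    (hPinj : ∀ i ≤ l, ∀ j ≤ l, P i = P j → i = j)
    (hPint : ∀ i, 0 < i → i < l → G.degree (P i) = 2)
    (hPend : G.degree (P l) = 1)
    (Q : ℕ → V) (hQ0 : Q 0 = u)
    (hQadj : ∀ i < m, G.Adj (Q i) (Q (i + 1)))
    (hQinj : ∀ i ≤ m, ∀ j ≤ m, Q i = Q j → i = j)
    (hQint : ∀ i, 0 < i → i < m → G.degree (Q i) = 2)
    (hQend : G.degree (Q m) = 1)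
    (hPQ : ∀ i, 0 < i → i ≤ l → ∀ j, 0 < j → j ≤ m → P i ≠ Q j)
    (G' : SimpleGraph V)
    (hG' : G'.edgeSet = (G.edgeSet \ {s(P (l - 1), P l)}) ∪ {s(Q m, P l)}) :
    somborIndex G' = somborIndex G := by
  have nP : ∀ i j, i ≤ l → j ≤ l → i ≠ j → P i ≠ P j := fun i j hi hj hne h =>
    hne (hPinj i hi j hj h)
  have hbc : G.Adj (P (l - 1)) (P l) := by
    have := hPadj (l - 1) (by omega)
    rwa [show l - 1 + 1 = l by omega] at this
  have hab : G.Adj (P (l - 2)) (P (l - 1)) := by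
    have := hPadj (l - 2) (by omega)
    rwa [show l - 2 + 1 = l - 1 by omega] at this
  have hed : G.Adj (Q (m - 1)) (Q m) := by
    have := hQadj (m - 1) (by omega)
    rwa [show m - 1 + 1 = m by omega] at this
  have hac : P (l - 2) ≠ P l := nP _ _ (by omega) (by omega) (by omega)
  apply sombor_core G G' (P (l - 2)) (P (l - 1)) (P l) (Q m) (Q (m - 1)) hab.ne hac
    (hPQ _ (by omega) (by omega) _ (by omega) (by omega)) hbc.ne
    (hPQ _ (by omega) (by omega) _ (by omega) (by omega))
    (hPQ _ (by omega) (by omega) _ (by omega) (by omega))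
    (hPQ _ (by omega) (by omega) _ (by omega) (by omega))
    (hPQ _ (by omega) (by omega) _ (by omega) (by omega)) hed.ne.symm
  · symm
    apply Set.eq_of_subset_of_ncard_le
    · intro x hx
      rcases hx with rfl | rfl
      · exact hab.symm
      · exact hbc
    · rw [Set.ncard_pair hac, ← degree_eq_ncard, hPint _ (by omega) (by omega)]
    · exact Set.toFinite _
  · symm
    apply Set.eq_of_subset_of_ncard_le
    · intro x hx
      rcases hx with rfl
      exact hbc.symm
    · rw [Set.ncard_singleton, ← degree_eq_ncard, hPend]
    · exact Set.toFinite _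
  · symm
    apply Set.eq_of_subset_of_ncard_le
    · intro x hx
      rcases hx with rfl
      exact hed.symm
    · rw [Set.ncard_singleton, ← degree_eq_ncard, hQend]
    · exact Set.toFinite _
  · rw [← degree_eq_ncard, hPint _ (by omega) (by omega)]
  · rw [← degree_eq_ncard, hQint _ (by omega) (by omega)]
  · exact hG'
end

section
/- Let G be a unicyclic graph containing a cycle, let u be a vertex on the cycle with cycle-neighbors x and y, and let v be a vertex not on the cycle with u adjacent to v and deg(v) ≥ 3, such that v is the only vertex of degree ≥ 3 in the tree component containing v obtained by deleting the edge u v. Write N(u) = {x, y, v} ∪ {u₁,…,u_n} and N(v) = {u} ∪ {v₁,…,v_m}, and suppose deg(u) ≥ deg(v) (i.e. n + 3 ≥ m + 1). Let G* be the graph obtained from G by deleting the edges v v_i and adding the edges u v_i for all 2 ≤ i ≤ m. Then SO(G*) > SO(G). -/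
open SimpleGraph

noncomputable def sqF (p q : ℝ) : ℝ := Real.sqrt (p ^ 2 + q ^ 2)

lemma sqF_mono {p q p' q' : ℝ} (hp : 0 ≤ p) (hq : 0 ≤ q) (h1 : p ≤ p') (h2 : q ≤ q') :
    sqF p q ≤ sqF p' q' := by
  unfold sqF
  apply Real.sqrt_le_sqrt
  gcongr

noncomputable def sqW {V : Type*} (D : V → ℝ) : Sym2 V → ℝ :=
  Sym2.lift ⟨fun a b => sqF (D a) (D b), fun a b => by simp [sqF, add_comm]⟩

lemma sqF_main (a b : ℝ) (hab : b ≤ a) (hb : 3 ≤ b) :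
    sqF b 2 + sqF a b + (b - 2) < 2 * sqF (a + b - 2) 2 := by
  have h1 : sqF b 2 ≤ b + 61 / 100 := by
    unfold sqF
    rw [Real.sqrt_le_left (by linarith)]
    nlinarith
  have h2 : sqF a b ≤ a + 5 / 12 * b := by
    unfold sqF
    rw [Real.sqrt_le_left (by linarith)]
    nlinarith
  have h3 : 894 / 1000 * (a + b - 2 + 1) ≤ sqF (a + b - 2) 2 := by
    unfold sqF
    apply Real.le_sqrt_of_sq_le
    nlinarith [sq_nonneg (a + b - 2 - 3.981)]
  linarith

lemma sqF_lip (b d : ℝ) (hb : 3 ≤ b) : sqF b d ≤ sqF 2 d + (b - 2) := by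
  have h0 : 0 ≤ sqF 2 d := Real.sqrt_nonneg _
  have h2 : (2 : ℝ) ≤ sqF 2 d := by
    unfold sqF
    apply Real.le_sqrt_of_sq_le
    nlinarith [sq_nonneg d]
  have h1 : sqF 2 d ^ 2 = 2 ^ 2 + d ^ 2 := Real.sq_sqrt (by positivity)
  have : sqF b d = Real.sqrt (b ^ 2 + d ^ 2) := rfl
  rw [this, Real.sqrt_le_left (by linarith)]
  nlinarith

lemma sqF_diff (s b d : ℝ) (hb : 3 ≤ b) (hs : b ≤ s) (hd0 : 0 ≤ d) (hd : d ≤ 2) :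
    sqF s 2 - sqF b 2 ≤ sqF s d - sqF b d := by
  have e1 : sqF s 2 ^ 2 = s ^ 2 + 2 ^ 2 := Real.sq_sqrt (by positivity)
  have e2 : sqF b 2 ^ 2 = b ^ 2 + 2 ^ 2 := Real.sq_sqrt (by positivity)
  have e3 : sqF s d ^ 2 = s ^ 2 + d ^ 2 := Real.sq_sqrt (by positivity)
  have e4 : sqF b d ^ 2 = b ^ 2 + d ^ 2 := Real.sq_sqrt (by positivity)
  have m1 : sqF s d ≤ sqF s 2 := sqF_mono (by linarith) hd0 le_rfl hd
  have m2 : sqF b d ≤ sqF b 2 := sqF_mono (by linarith) hd0 le_rfl hd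
  have m3 : sqF b d ≤ sqF s d := sqF_mono (by linarith) hd0 hs le_rfl
  have p4 : 0 < sqF b d := Real.sqrt_pos.2 (by positivity)
  by_contra! hlt
  have k1 : (sqF s 2 - sqF b 2) * (sqF s 2 + sqF b 2) = s ^ 2 - b ^ 2 := by linarith [e1, e2]
  have k2 : (sqF s d - sqF b d) * (sqF s d + sqF b d) = s ^ 2 - b ^ 2 := by linarith [e3, e4]
  have k3 : (sqF s d - sqF b d) * (sqF s d + sqF b d)
      < (sqF s 2 - sqF b 2) * (sqF s d + sqF b d) :=
    mul_lt_mul_of_pos_right hlt (by linarith)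
  have k4 : (sqF s 2 - sqF b 2) * (sqF s d + sqF b d)
      ≤ (sqF s 2 - sqF b 2) * (sqF s 2 + sqF b 2) :=
    mul_le_mul_of_nonneg_left (by linarith) (by linarith)
  linarith

lemma somborIndex_eq {V : Type*} [Fintype V] [DecidableEq V] (G : SimpleGraph V)
    [DecidableRel G.Adj] :
    somborIndex G = ∑ e ∈ G.edgeFinset, sqW (fun z => (G.degree z : ℝ)) e := by
  unfold somborIndex sqW sqF
  apply Finset.sum_congr
  · ext e; simp
  · intro e _
    induction e using Sym2.ind with
    | _ a b => 
      simp only [Sym2.lift_mk]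
      congr!

/-- Lemma 3.4(a): `u` is on the cycle with cycle-neighbours `x, y`, the tree
attached to `u` through `v` has `v` as its only vertex of degree `≥ 3`, and
`deg u ≥ deg v`.  Moving the branches `v₂, …, v_m` of `v` over to `u`
strictly increases the Sombor index. -/
theorem sombor_unicyclic_shift_a {V : Type*} [Fintype V]
    (G : SimpleGraph V) [DecidableRel G.Adj] (hG : Unicyclic G)
    (u x y v : V) (c : G.Walk u u) (hc : c.IsCycle)
    (hx : s(u, x) ∈ c.edges) (hy : s(u, y) ∈ c.edges) (hxy : x ≠ y)
    (hv : v ∉ c.support) (huv : G.Adj u v) (hdv3 : 3 ≤ G.degree v)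
    (honly : ∀ z : V, (G.deleteEdges {s(u, v)}).Reachable v z → 3 ≤ G.degree z → z = v)
    (n m : ℕ)
    (U : Fin n → V) (hUinj : Function.Injective U)
    (hU : G.neighborSet u = {x, y, v} ∪ Set.range U) (hdu : G.degree u = n + 3)
    (W : Fin m → V) (hWinj : Function.Injective W)
    (hW : G.neighborSet v = {u} ∪ Set.range W) (hdv : G.degree v = m + 1)
    (hduv : G.degree v ≤ G.degree u)
    (G' : SimpleGraph V)
    (hG' : G'.edgeSet =
      (G.edgeSet \ {e | ∃ i : Fin m, (i : ℕ) ≠ 0 ∧ e = s(v, W i)}) ∪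
        {e | ∃ i : Fin m, (i : ℕ) ≠ 0 ∧ e = s(u, W i)}) :
    somborIndex G < somborIndex G' := by
  classical
  have hm : 2 ≤ m := by omega
  let i0 : Fin m := ⟨0, by omega⟩
  let i1 : Fin m := ⟨1, by omega⟩
  have huvne : u ≠ v := huv.ne
  -- neighbours
  have hvW : ∀ i, G.Adj v (W i) := fun i => by
    have : W i ∈ G.neighborSet v := by rw [hW]; simp
    exact this
  have hWv : ∀ i, W i ≠ v := fun i => (hvW i).ne'
  have hWu : ∀ i, W i ≠ u := by
    intro i hi
    have hcard : (G.neighborFinset v).card ≤ m := by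
      have : G.neighborFinset v ⊆ Finset.univ.image W := by
        intro z hz
        have hz' : z ∈ G.neighborSet v := by simpa using hz
        rw [hW] at hz'
        rcases hz' with hz' | ⟨j, rfl⟩
        · rw [Set.mem_singleton_iff] at hz'
          rw [hz', ← hi]; simp
        · simp
      refine (Finset.card_le_card this).trans (Finset.card_image_le.trans (by simp))
    rw [G.card_neighborFinset_eq_degree] at hcard
    omega
  have hreach : ∀ i, (G.deleteEdges {s(u, v)}).Reachable v (W i) := by
    intro i
    apply SimpleGraph.Adj.reachable
    rw [SimpleGraph.deleteEdges_adj]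
    refine ⟨hvW i, ?_⟩
    have := hWu i
    have := hWv i
    simp only [Set.mem_singleton_iff, Sym2.eq_iff]
    grind
  have huW : ∀ i, ¬ G.Adj u (W i) := by
    intro i hi
    apply huvne
    apply honly u _ (by omega)
    refine (hreach i).trans ?_
    apply SimpleGraph.Adj.reachable
    rw [SimpleGraph.deleteEdges_adj]
    refine ⟨hi.symm, ?_⟩
    have := hWu i
    have := hWv i
    simp only [Set.mem_singleton_iff, Sym2.eq_iff]
    grind
  have hdW : ∀ i, G.degree (W i) ≤ 2 := by
    intro i
    by_contra! h
    exact hWv i (honly _ (hreach i) h)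
  have hvadj : ∀ z, G.Adj v z → z = u ∨ ∃ i, z = W i := by
    intro z hz
    have hz' : z ∈ G.neighborSet v := hz
    rw [hW] at hz'
    rcases hz' with hz' | ⟨j, rfl⟩
    · left; simpa using hz'
    · right; exact ⟨j, rfl⟩
  -- adjacency in the new graph
  have hadj' : ∀ p q, s(p, q) ∈ (G.edgeSet \ {e | ∃ i : Fin m, (i : ℕ) ≠ 0 ∧ e = s(v, W i)}) ∪
        {e | ∃ i : Fin m, (i : ℕ) ≠ 0 ∧ e = s(u, W i)} → G'.Adj p q := by
    intro p q h
    rw [← hG'] at h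
    exact h
  have hkeep : ∀ p q, G.Adj p q → p ≠ v → q ≠ v → G'.Adj p q := by
    intro p q h hp hq
    refine hadj' p q (Or.inl ⟨h, ?_⟩)
    rintro ⟨i, _, he⟩
    rw [Sym2.eq_iff] at he
    grind
  have huW' : ∀ i : Fin m, (i : ℕ) ≠ 0 → G'.Adj u (W i) := fun i hi =>
    hadj' _ _ (Or.inr ⟨i, hi, rfl⟩)
  have huv' : G'.Adj u v := by
    refine hadj' _ _ (Or.inl ⟨huv, ?_⟩)
    rintro ⟨i, _, he⟩
    rw [Sym2.eq_iff] at he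
    have := hWu i
    grind
  have hvW0' : G'.Adj v (W i0) := by
    refine hadj' _ _ (Or.inl ⟨hvW i0, ?_⟩)
    rintro ⟨i, hi, he⟩
    rw [Sym2.eq_iff] at he
    have := hWv i
    have h2 : W i0 = W i := by grind
    have := hWinj h2
    rw [← this] at hi
    exact hi rfl
  let I : Finset (Fin m) := Finset.univ.erase i0
  have hI : ∀ i : Fin m, i ∈ I ↔ (i : ℕ) ≠ 0 := by
    intro i
    simp [I, i0, Fin.ext_iff]
  have hIcard : I.card = m - 1 := by simp [I]
  -- degrees
  have hdegv : 2 ≤ G'.degree v := by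
    rw [← G'.card_neighborFinset_eq_degree, ← Finset.card_pair (hWu i0).symm]
    apply Finset.card_le_card
    intro z hz
    simp only [Finset.mem_insert, Finset.mem_singleton] at hz
    rw [SimpleGraph.mem_neighborFinset]
    rcases hz with rfl | rfl
    · exact huv'.symm
    · exact hvW0'
  have hdegu : G.degree u + (m - 1) ≤ G'.degree u := by
    rw [← G'.card_neighborFinset_eq_degree, ← G.card_neighborFinset_eq_degree, ← hIcard,
      ← Finset.card_image_of_injective I hWinj, ← Finset.card_union_of_disjoint]
    · apply Finset.card_le_card
      intro z hz
      rw [SimpleGraph.mem_neighborFinset]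
      rcases Finset.mem_union.1 hz with hz | hz
      · rw [SimpleGraph.mem_neighborFinset] at hz
        by_cases hzv : z = v
        · rw [hzv]; exact huv'
        · exact hkeep _ _ hz huvne hzv
      · obtain ⟨i, hi, rfl⟩ := Finset.mem_image.1 hz
        exact huW' i ((hI i).1 hi)
    · rw [Finset.disjoint_left]
      intro z hz hz'
      obtain ⟨i, hi, rfl⟩ := Finset.mem_image.1 hz'
      rw [SimpleGraph.mem_neighborFinset] at hz
      exact huW i hz
  have hdeg : ∀ z, z ≠ u → z ≠ v → G.degree z ≤ G'.degree z := by
    intro z hzu hzv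
    rw [← G'.card_neighborFinset_eq_degree, ← G.card_neighborFinset_eq_degree]
    by_cases hz : ∃ i : Fin m, (i : ℕ) ≠ 0 ∧ z = W i
    · obtain ⟨i, hi, rfl⟩ := hz
      have hu : u ∉ (G.neighborFinset (W i)).erase v := by
        intro h
        have h2 := Finset.mem_of_mem_erase h
        rw [SimpleGraph.mem_neighborFinset] at h2
        exact huW i h2.symm
      have hvm : v ∈ G.neighborFinset (W i) := by
        rw [SimpleGraph.mem_neighborFinset]; exact (hvW i).symm
      rw [← Finset.card_erase_add_one hvm, ← Finset.card_insert_of_notMem hu]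
      apply Finset.card_le_card
      intro w hw
      rw [SimpleGraph.mem_neighborFinset]
      rcases Finset.mem_insert.1 hw with rfl | hw
      · exact (huW' i hi).symm
      · rw [Finset.mem_erase, SimpleGraph.mem_neighborFinset] at hw
        exact hkeep _ _ hw.2 hzv hw.1
    · apply Finset.card_le_card
      intro w hw
      rw [SimpleGraph.mem_neighborFinset] at hw ⊢
      by_cases hwv : w = v
      · subst hwv
        rcases hvadj z hw.symm with h | ⟨i, hi⟩
        · exact absurd h hzu
        · by_cases h0 : (i : ℕ) = 0
          · have : i = i0 := Fin.ext h0
            rw [hi, this]; exact hvW0'.symm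
          · exact absurd ⟨i, h0, hi⟩ hz
      · exact hkeep _ _ hw hzv hwv
  have hdegW : ∀ i, G.degree (W i) ≤ G'.degree (W i) := fun i => hdeg _ (hWu i) (hWv i)
  have hdeg' : ∀ z, z ≠ v → G.degree z ≤ G'.degree z := by
    intro z hzv
    by_cases hzu : z = u
    · subst hzu; omega
    · exact hdeg z hzu hzv
  -- edge decomposition
  let R : Finset (Sym2 V) := I.image (fun i => s(v, W i))
  let R' : Finset (Sym2 V) := I.image (fun i => s(u, W i))
  let K : Finset (Sym2 V) := G.edgeFinset \ R
  have hRsub : R ⊆ G.edgeFinset := by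
    intro e he
    obtain ⟨i, _, rfl⟩ := Finset.mem_image.1 he
    rw [SimpleGraph.mem_edgeFinset]
    exact hvW i
  have hE' : G'.edgeFinset = K ∪ R' := by
    ext e
    rw [SimpleGraph.mem_edgeFinset, hG']
    simp only [K, R, R', Set.mem_union, Set.mem_sdiff, Set.mem_ofPred_eq, Finset.mem_union,
      Finset.mem_sdiff, SimpleGraph.mem_edgeFinset, Finset.mem_image, hI, eq_comm]
  have hdisj : Disjoint K R' := by
    rw [Finset.disjoint_left]
    intro e he he'
    obtain ⟨i, _, rfl⟩ := Finset.mem_image.1 he'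
    have h := (Finset.mem_sdiff.1 he).1
    rw [SimpleGraph.mem_edgeFinset] at h
    exact huW i h
  let D : V → ℝ := fun z => (G.degree z : ℝ)
  let D' : V → ℝ := fun z => (G'.degree z : ℝ)
  have hD0 : ∀ z, 0 ≤ D z := fun z => Nat.cast_nonneg _
  have hDD : ∀ z, z ≠ v → D z ≤ D' z := fun z hz => Nat.cast_le.2 (hdeg' z hz)
  have hS : somborIndex G = ∑ e ∈ K, sqW D e + ∑ i ∈ I, sqF (D v) (D (W i)) := by
    rw [somborIndex_eq, ← Finset.sum_sdiff hRsub]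
    congr 1
    rw [Finset.sum_image]
    · rfl
    · intro i _ j _ hij
      apply hWinj
      have := hWv i
      have := hWv j
      simp only [Sym2.eq_iff] at hij
      grind
  have hS' : somborIndex G' = ∑ e ∈ K, sqW D' e + ∑ i ∈ I, sqF (D' u) (D' (W i)) := by
    rw [somborIndex_eq, hE', Finset.sum_union hdisj]
    congr 1
    rw [Finset.sum_image]
    · rfl
    · intro i _ j _ hij
      apply hWinj
      have := hWu i
      have := hWu j
      simp only [Sym2.eq_iff] at hij
      grind
  have hDu : D u + D v - 2 ≤ D' u := by
    have : G.degree u + G.degree v ≤ G'.degree u + 2 := by omega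
    have h2 : (G.degree u : ℝ) + G.degree v ≤ G'.degree u + 2 := by exact_mod_cast this
    simp only [D, D']
    linarith
  have hDv : 2 ≤ D' v := by simp only [D']; exact_mod_cast hdegv
  have hDv3 : 3 ≤ D v := by simp only [D]; exact_mod_cast hdv3
  have hDuv : D v ≤ D u := by simp only [D]; exact_mod_cast hduv
  have hDW1 : D (W i1) ≤ 2 := by simp only [D]; exact_mod_cast hdW i1
  have hi1 : i1 ∈ I := (hI i1).2 (by simp [i1])
  have hIsum : sqF (D' u) (D' (W i1)) - sqF (D v) (D (W i1)) ≤
      ∑ i ∈ I, (sqF (D' u) (D' (W i)) - sqF (D v) (D (W i))) := by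
    apply Finset.single_le_sum (f := fun i => sqF (D' u) (D' (W i)) - sqF (D v) (D (W i))) _ hi1
    intro i _
    have := sqF_mono (hD0 v) (hD0 (W i)) (by linarith : D v ≤ D' u) (hDD _ (hWv i))
    linarith
  have hne : s(u, v) ≠ s(v, W i0) := by
    have := hWu i0
    rw [Ne, Sym2.eq_iff]
    grind
  have hsub : ({s(u, v), s(v, W i0)} : Finset (Sym2 V)) ⊆ K := by
    intro e he
    simp only [Finset.mem_insert, Finset.mem_singleton] at he
    have h1 : e ∈ G.edgeFinset := by
      rw [SimpleGraph.mem_edgeFinset]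
      rcases he with rfl | rfl
      · exact huv
      · exact hvW i0
    refine Finset.mem_sdiff.2 ⟨h1, ?_⟩
    intro h2
    obtain ⟨i, hi, h3⟩ := Finset.mem_image.1 h2
    have := hWu i
    have := hWv i
    rcases he with rfl | rfl
    · rw [Sym2.eq_iff] at h3
      grind
    · rw [Sym2.eq_iff] at h3
      have h4 : W i = W i0 := by grind
      exact (Finset.mem_erase.1 hi).1 (hWinj h4)
  have hKsum : (sqF (D' u) (D' v) - sqF (D u) (D v)) +
      (sqF (D' v) (D' (W i0)) - sqF (D v) (D (W i0))) ≤ ∑ e ∈ K, (sqW D' e - sqW D e) := by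
    have h1 : ∑ e ∈ ({s(u, v), s(v, W i0)} : Finset (Sym2 V)), (sqW D' e - sqW D e) =
        (sqF (D' u) (D' v) - sqF (D u) (D v)) +
        (sqF (D' v) (D' (W i0)) - sqF (D v) (D (W i0))) := by
      rw [Finset.sum_pair hne]
      rfl
    rw [← h1]
    apply Finset.sum_le_sum_of_subset_of_nonneg hsub
    intro e heK he
    have heE := (Finset.mem_sdiff.1 heK).1
    have heR := (Finset.mem_sdiff.1 heK).2
    have hve : v ∉ e := by
      intro hve
      obtain ⟨z, rfl⟩ := hve
      rw [SimpleGraph.mem_edgeFinset] at heE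
      rcases hvadj z heE with rfl | ⟨i, rfl⟩
      · apply he
        simp [Sym2.eq_swap]
      · by_cases hi : i ∈ I
        · exact heR (Finset.mem_image.2 ⟨i, hi, rfl⟩)
        · have : i = i0 := by
            by_contra h
            exact hi (Finset.mem_erase.2 ⟨h, Finset.mem_univ _⟩)
          apply he
          simp [this]
    induction e using Sym2.ind with
    | _ p q =>
      have hp : p ≠ v := by rintro rfl; simp at hve
      have hq : q ≠ v := by rintro rfl; simp at hve
      have := sqF_mono (hD0 p) (hD0 q) (hDD p hp) (hDD q hq)
      change 0 ≤ sqF (D' p) (D' q) - sqF (D p) (D q)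
      linarith
  have f1 : sqF (D u + D v - 2) 2 ≤ sqF (D' u) (D' v) :=
    sqF_mono (by linarith) (by norm_num) hDu hDv
  have f2 : sqF 2 (D (W i0)) ≤ sqF (D' v) (D' (W i0)) :=
    sqF_mono (by norm_num) (hD0 _) hDv (hDD _ (hWv i0))
  have f3 : sqF (D u + D v - 2) (D (W i1)) ≤ sqF (D' u) (D' (W i1)) :=
    sqF_mono (by linarith) (hD0 _) hDu (hDD _ (hWv i1))
  have f4 := sqF_main (D u) (D v) hDuv hDv3
  have f5 := sqF_lip (D v) (D (W i0)) hDv3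
  have f6 := sqF_diff (D u + D v - 2) (D v) (D (W i1)) hDv3 (by linarith) (hD0 _) hDW1
  rw [Finset.sum_sub_distrib] at hIsum hKsum
  rw [hS, hS']
  linarith
end

section
/- Let G be a unicyclic graph containing a cycle, let u be a vertex on the cycle with cycle-neighbors x and y satisfying deg(y) ≥ deg(x), and let w, v be vertices not on the cycle with u adjacent to w, w adjacent to v, deg(w) = 2 and deg(v) ≥ 3, such that v is the only vertex of degree ≥ 3 in the tree component containing w and v obtained by deleting the edge u w. Write N(u) = {x, y, w} ∪ {u₁,…,u_n} and N(v) = {w} ∪ {v₁,…,v_m}, and suppose deg(v) > deg(u) (i.e. m > n + 2). Let G* be the graph obtained from G by deleting the edges u u_i for all 1 ≤ i ≤ n and the edge u x, and adding the edges v u_i for all 1 ≤ i ≤ n and the edge v x. Then SO(G*) > SO(G). -/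
open SimpleGraph

/-- Edge weight for a given degree function. -/
noncomputable def sfun {V : Type*} (d : V → ℕ) : Sym2 V → ℝ :=
  Sym2.lift ⟨fun a b => Real.sqrt ((d a : ℝ) ^ 2 + (d b : ℝ) ^ 2),
      fun a b => by simp [add_comm]⟩

theorem sfun_mk {V : Type*} (d : V → ℕ) (a b : V) :
    sfun d s(a, b) = Real.sqrt ((d a : ℝ) ^ 2 + (d b : ℝ) ^ 2) := rfl

theorem sombor_eq_s15 {V : Type*} [Fintype V] [DecidableEq V] (G : SimpleGraph V)
    [DecidableRel G.Adj] :
    somborIndex G = ∑ e ∈ G.edgeFinset, sfun (fun z => G.degree z) e := by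
  unfold somborIndex sfun
  congr!

/-- Monotonicity of `s ↦ √(s²+t²)`. -/
theorem sqrt_mono' {p q r s : ℝ} (hp : 0 ≤ p) (hr : 0 ≤ r) (h : p ≤ q) (h' : r ≤ s) :
    Real.sqrt (p ^ 2 + r ^ 2) ≤ Real.sqrt (q ^ 2 + s ^ 2) := by
  apply Real.sqrt_le_sqrt
  gcongr

/-- Losing at `y` is less than losing at `x`. -/
theorem loss_anti {p q s t : ℝ} (hp : 0 < p) (hpq : p ≤ q) (hs : 0 ≤ s) (hst : s ≤ t) :
    Real.sqrt (q ^ 2 + t ^ 2) - Real.sqrt (p ^ 2 + t ^ 2) ≤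
      Real.sqrt (q ^ 2 + s ^ 2) - Real.sqrt (p ^ 2 + s ^ 2) := by
  have h1 := sqrt_mono' hp.le (hs.trans hst) hpq (le_refl t)
  have h2 := sqrt_mono' hp.le hs hpq (le_refl s)
  have h3 := sqrt_mono' hp.le hs (le_refl p) hst
  have h4 := sqrt_mono' (hp.le.trans hpq) hs (le_refl q) hst
  have e1 := Real.sq_sqrt (show 0 ≤ q ^ 2 + t ^ 2 by positivity)
  have e2 := Real.sq_sqrt (show 0 ≤ p ^ 2 + t ^ 2 by positivity)
  have e3 := Real.sq_sqrt (show 0 ≤ q ^ 2 + s ^ 2 by positivity)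
  have e4 := Real.sq_sqrt (show 0 ≤ p ^ 2 + s ^ 2 by positivity)
  have hq : 0 < q := hp.trans_le hpq
  have p1 := Real.sqrt_pos.2 (show 0 < q ^ 2 + t ^ 2 by positivity)
  have p2 := Real.sqrt_pos.2 (show 0 < p ^ 2 + t ^ 2 by positivity)
  have p3 : 0 ≤ Real.sqrt (q ^ 2 + s ^ 2) := Real.sqrt_nonneg _
  have p4 := Real.sqrt_pos.2 (show 0 < p ^ 2 + s ^ 2 by positivity)
  generalize Real.sqrt (q ^ 2 + t ^ 2) = A at *
  generalize Real.sqrt (p ^ 2 + t ^ 2) = B at *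
  generalize Real.sqrt (q ^ 2 + s ^ 2) = C at *
  generalize Real.sqrt (p ^ 2 + s ^ 2) = D at *
  by_contra! h
  have : (A - B) * (A + B) = (C - D) * (C + D) := by nlinarith
  nlinarith

/-- Convexity of `s ↦ √(s²+t²)`, as an increment inequality. -/
theorem incr_mono {p q h t : ℝ} (hp : 0 < p) (hpq : p ≤ q) (hh : 0 ≤ h) :
    Real.sqrt ((p + h) ^ 2 + t ^ 2) - Real.sqrt (p ^ 2 + t ^ 2) ≤
      Real.sqrt ((q + h) ^ 2 + t ^ 2) - Real.sqrt (q ^ 2 + t ^ 2) := by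
  have hq : 0 < q := hp.trans_le hpq
  have e1 := Real.sq_sqrt (show 0 ≤ (p + h) ^ 2 + t ^ 2 by positivity)
  have e2 := Real.sq_sqrt (show 0 ≤ p ^ 2 + t ^ 2 by positivity)
  have e3 := Real.sq_sqrt (show 0 ≤ (q + h) ^ 2 + t ^ 2 by positivity)
  have e4 := Real.sq_sqrt (show 0 ≤ q ^ 2 + t ^ 2 by positivity)
  have p1 := Real.sqrt_nonneg ((p + h) ^ 2 + t ^ 2)
  have p2 := Real.sqrt_nonneg (p ^ 2 + t ^ 2)
  have p3 := Real.sqrt_nonneg ((q + h) ^ 2 + t ^ 2)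
  have p4 := Real.sqrt_nonneg (q ^ 2 + t ^ 2)
  generalize Real.sqrt ((p + h) ^ 2 + t ^ 2) = A at *
  generalize Real.sqrt (p ^ 2 + t ^ 2) = B at *
  generalize Real.sqrt ((q + h) ^ 2 + t ^ 2) = C at *
  generalize Real.sqrt (q ^ 2 + t ^ 2) = D at *
  have hBC : p * (q + h) - t ^ 2 ≤ B * C := by
    have h1 : (p * (q + h) + t ^ 2) ^ 2 ≤ (B * C) ^ 2 := by
      rw [mul_pow, e2, e3]
      nlinarith [mul_nonneg (sq_nonneg t) (sq_nonneg (q + h - p))]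
    have h2 := abs_le_of_sq_le_sq' h1 (by positivity)
    nlinarith [h2.2, sq_nonneg t]
  have hAD : A * D ≤ B * C + (q - p) * h := by
    have hk : 0 ≤ (q - p) * h := mul_nonneg (by linarith) hh
    refine (sq_le_sq₀ (by positivity) (by positivity)).1 ?_
    have : (A * D) ^ 2 - (B * C) ^ 2 - ((q - p) * h) ^ 2
        = 2 * ((q - p) * h) * (p * (q + h) - t ^ 2) := by
      rw [mul_pow, mul_pow, e1, e2, e3, e4]; ring
    nlinarith [mul_le_mul_of_nonneg_left hBC hk]
  have : A + D ≤ B + C := by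
    refine (sq_le_sq₀ (by positivity) (by positivity)).1 ?_
    nlinarith
  linarith

theorem final_ineq {a b : ℕ} (ha : 3 ≤ a) (hab : a < b) {dx dy : ℕ} (hd : dx ≤ dy) :
    Real.sqrt ((a:ℝ) ^ 2 + 2 ^ 2) + Real.sqrt (2 ^ 2 + (b:ℝ) ^ 2)
      + Real.sqrt ((a:ℝ) ^ 2 + (dy:ℝ) ^ 2) + Real.sqrt ((a:ℝ) ^ 2 + (dx:ℝ) ^ 2) <
    Real.sqrt ((2:ℝ) ^ 2 + 2 ^ 2) + Real.sqrt (2 ^ 2 + ((a + b - 2 : ℕ):ℝ) ^ 2)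
      + Real.sqrt ((2:ℝ) ^ 2 + (dy:ℝ) ^ 2)
      + Real.sqrt (((a + b - 2 : ℕ):ℝ) ^ 2 + (dx:ℝ) ^ 2) := by
  have hc : ((a + b - 2 : ℕ):ℝ) = (a:ℝ) + b - 2 := by
    rw [Nat.cast_sub (by omega)]; push_cast; ring
  rw [hc]
  have ha' : (3:ℝ) ≤ a := by exact_mod_cast ha
  have hab' : (a:ℝ) + 1 ≤ b := by exact_mod_cast hab
  have hd' : (dx:ℝ) ≤ dy := by exact_mod_cast hd
  have h1 := loss_anti (p := 2) (q := a) (s := dx) (t := dy) (by norm_num) (by linarith)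
    (by positivity) hd'
  have h2 := incr_mono (p := 2) (q := a) (h := a - 2) (t := dx) (by norm_num) (by linarith)
    (by linarith)
  have h3 := incr_mono (p := 2) (q := b) (h := a - 2) (t := 2) (by norm_num) (by linarith)
    (by linarith)
  have h4 : Real.sqrt (((a:ℝ) + (a - 2)) ^ 2 + (dx:ℝ) ^ 2) <
      Real.sqrt (((a:ℝ) + b - 2) ^ 2 + (dx:ℝ) ^ 2) := by
    apply Real.sqrt_lt_sqrt (by positivity)
    have : ((a:ℝ) + (a - 2)) ^ 2 < ((a:ℝ) + b - 2) ^ 2 := by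
      apply pow_lt_pow_left₀ (by linarith) (by linarith) (by norm_num)
    linarith
  rw [show (2:ℝ) + (a - 2) = a by ring] at h2 h3
  rw [show (b:ℝ) + (a - 2) = a + b - 2 by ring] at h3
  rw [add_comm ((2:ℝ)^2) ((b:ℝ)^2), add_comm ((2:ℝ)^2) (((a:ℝ) + b - 2)^2)]
  linarith

/-- In a unicyclic graph an edge off the cycle is a bridge. -/
theorem off_cycle_bridge {V : Type*} [Fintype V] (G : SimpleGraph V) (hG : Unicyclic G)
    (u x w : V) (c : G.Walk u u) (hc : c.IsCycle) (hx : s(u, x) ∈ c.edges)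
    (hw : w ∉ c.support) (huw : G.Adj u w) :
    ¬ (G.deleteEdges {s(u, w)}).Reachable u w := by
  classical
  intro hr
  obtain ⟨hconn, hcard⟩ := hG
  have hnb : ¬ G.IsBridge s(u, w) := by
    rw [SimpleGraph.isBridge_iff]
    tauto
  have hc1 : (G.deleteEdges {s(u, w)}).Connected :=
    hconn.connected_delete_edge_of_not_isBridge hnb
  have huwc : s(u, w) ∉ c.edges := fun h => hw (c.snd_mem_support_of_mem_edges h)
  have hc' := hc.toDeleteEdges (s := {s(u, w)}) (hp := fun e he h => huwc (by
    rw [Set.mem_singleton_iff] at h; exact h ▸ he))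
  have hc2 : ((G.deleteEdges {s(u, w)}).deleteEdges {s(u, x)}).Connected := by
    apply hc1.connected_delete_edge_of_not_isBridge
    intro hb
    apply hb.notMem_edges_of_isCycle hc'
    simpa using hx
  have h := hc2.card_vert_le_card_edgeSet_add_one
  have hux : G.Adj u x := c.adj_of_mem_edges hx
  have hne : s(u, w) ≠ s(u, x) := fun h => huwc (h ▸ hx)
  have hE : ((G.deleteEdges {s(u, w)}).deleteEdges {s(u, x)}).edgeSet =
      (((G.edgeFinset.erase s(u, w)).erase s(u, x) : Finset (Sym2 V)) : Set (Sym2 V)) := by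
    ext e
    simp [SimpleGraph.edgeSet_deleteEdges]
    tauto
  rw [hE, Nat.card_eq_fintype_card, Nat.card_coe_set_eq, Set.ncard_coe_finset,
    Finset.card_erase_of_mem, Finset.card_erase_of_mem] at h
  · have hcard' : G.edgeFinset.card = Fintype.card V := by convert hcard
    have : 0 < Fintype.card V := Fintype.card_pos_iff.2 ⟨u⟩
    have h2 : ({s(u,w), s(u,x)} : Finset (Sym2 V)) ⊆ G.edgeFinset := by
      intro e he
      simp at he
      rcases he with rfl | rfl <;> simpa
    have h3 := Finset.card_le_card h2
    rw [Finset.card_pair hne] at h3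
    omega
  · simpa
  · simp [hux, hne.symm]

theorem prop_aux (A B C D X Y : Prop) :
    ((A ∧ C) ∨ (B ∧ D)) ∨ (A ∧ X ∨ Y ∧ B) ↔ A ∧ (X ∨ C) ∨ B ∧ (Y ∨ D) := by
  tauto

theorem edge_aux1 {V : Type*} {p q u w v y : V} {A P Q : Prop}
    (h1 : p = u → (A ↔ q = y ∨ q = w ∨ Q)) (h2 : q = u → (A ↔ p = y ∨ p = w ∨ P))
    (h3 : p = w → q = v → A) (h4 : p = v → q = w → A) :
    A ↔ (p = u ∧ q = w ∨ p = w ∧ q = u) ∨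
      (p = w ∧ q = v ∨ p = v ∧ q = w) ∨ (p = u ∧ q = y ∨ p = y ∧ q = u) ∨
      ((p = u ∧ Q) ∨ (q = u ∧ P)) ∨ (A ∧ p ≠ u ∧ q ≠ u ∧ ¬ (p = w ∧ q = v) ∧
      ¬ (p = v ∧ q = w)) := by
  constructor
  · intro hA
    by_cases hp : p = u
    · grind
    · by_cases hq : q = u
      · grind
      · by_cases e1 : p = w ∧ q = v
        · exact Or.inr (Or.inl (Or.inl e1))
        · by_cases e2 : p = v ∧ q = w
          · exact Or.inr (Or.inl (Or.inr e2))
          · exact Or.inr (Or.inr (Or.inr (Or.inr ⟨hA, hp, hq, e1, e2⟩)))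
  · rintro (h | h | h | h | h)
    · rcases h with ⟨a, b⟩ | ⟨a, b⟩
      · exact (h1 a).2 (Or.inr (Or.inl b))
      · exact (h2 b).2 (Or.inr (Or.inl a))
    · rcases h with ⟨a, b⟩ | ⟨a, b⟩
      · exact h3 a b
      · exact h4 a b
    · rcases h with ⟨a, b⟩ | ⟨a, b⟩
      · exact (h1 a).2 (Or.inl b)
      · exact (h2 b).2 (Or.inl a)
    · rcases h with ⟨a, b⟩ | ⟨a, b⟩
      · exact (h1 a).2 (Or.inr (Or.inr b))
      · exact (h2 a).2 (Or.inr (Or.inr b))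
    · exact h.1

theorem edge_aux2 {V : Type*} {p q u w v y : V} {S : Finset V} {E : Prop}
    (huv : u ≠ v) (hyu : y ≠ u) (hwu : w ≠ u) (huS : u ∉ S) (hvS : v ∉ S) (hyS : y ∉ S)
    (hwS : w ∉ S) (hE : E → p ≠ u ∧ q ≠ u) :
    ((((p = u ∧ q = w ∨ p = w ∧ q = u) ∨
      (p = w ∧ q = v ∨ p = v ∧ q = w) ∨ (p = u ∧ q = y ∨ p = y ∧ q = u) ∨
      ((p = u ∧ q ∈ S) ∨ (q = u ∧ p ∈ S)) ∨ E) ∧ ¬ (p = u ∧ q ∈ S) ∧ ¬ (q = u ∧ p ∈ S)) ∨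
      (p = v ∧ q ∈ S) ∨ (q = v ∧ p ∈ S)) ↔
    (p = u ∧ q = w ∨ p = w ∧ q = u) ∨
      (p = w ∧ q = v ∨ p = v ∧ q = w) ∨ (p = u ∧ q = y ∨ p = y ∧ q = u) ∨
      ((p = v ∧ q ∈ S) ∨ (q = v ∧ p ∈ S)) ∨ E := by
  by_cases hp : p = u
  · subst hp
    grind
  · by_cases hq : q = u
    · subst hq
      grind
    · grind

set_option maxHeartbeats 1000000 in
/-- The combinatorial core. -/
theorem sombor_core_s15 {V : Type*} [Fintype V] [DecidableEq V]
    (G G' : SimpleGraph V) [DecidableRel G.Adj] [DecidableRel G'.Adj]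
    (u x y w v : V) (T : Finset V)
    (hyx : G.degree x ≤ G.degree y)
    (huv : u ≠ v) (hwv : G.Adj w v) (hyv : y ≠ v)
    (hdw : G.degree w = 2)
    (hxT : x ∉ T) (hyT : y ∉ insert x T) (hwT : w ∉ insert x T) (hyw : y ≠ w)
    (hvT : v ∉ insert x T)
    (hN : G.neighborFinset u = insert y (insert w (insert x T)))
    (hvS : ∀ z ∈ insert x T, ¬ G.Adj v z)
    (hduv : G.degree u < G.degree v)
    (hG' : ∀ p q, G'.Adj p q ↔
      (G.Adj p q ∧ ¬ (p = u ∧ q ∈ insert x T) ∧ ¬ (q = u ∧ p ∈ insert x T)) ∨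
      (p = v ∧ q ∈ insert x T) ∨ (q = v ∧ p ∈ insert x T)) :
    somborIndex G < somborIndex G' := by
  have hsumS : ∀ f : V → ℝ, ∑ z ∈ insert x T, f z = f x + ∑ z ∈ T, f z :=
    fun f => Finset.sum_insert hxT
  have hxS : x ∈ insert x T := by simp
  have hTS : ∀ z ∈ T, z ∈ insert x T := fun z hz => Finset.mem_insert_of_mem hz
  generalize insert x T = S at *
  have hadj : ∀ z, G.Adj u z ↔ z = y ∨ z = w ∨ z ∈ S := by
    intro z
    rw [← SimpleGraph.mem_neighborFinset, hN]; simp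
  have huS : u ∉ S := fun h => G.irrefl ((hadj u).2 (by tauto))
  have huy : G.Adj u y := (hadj y).2 (by tauto)
  have huw : G.Adj u w := (hadj w).2 (by tauto)
  have hyu : y ≠ u := huy.ne'
  have hwu : w ≠ u := huw.ne'
  have hwv' : w ≠ v := hwv.ne
  have hdu : G.degree u = S.card + 2 := by
    rw [← SimpleGraph.card_neighborFinset_eq_degree, hN, Finset.card_insert_of_notMem,
      Finset.card_insert_of_notMem hwT]
    simp [hyw, hyT]
  -- degrees in the new graph
  have hdu' : G'.degree u = 2 := by
    rw [← SimpleGraph.card_neighborFinset_eq_degree]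
    have : G'.neighborFinset u = {y, w} := by
      ext z
      rw [SimpleGraph.mem_neighborFinset, hG', hadj]
      simp only [Finset.mem_insert, Finset.mem_singleton]
      constructor
      · rintro (h | h | h) <;> tauto
      · rintro (rfl | rfl) <;> simp_all
    rw [this, Finset.card_pair hyw]
  have hdv' : G'.degree v = G.degree u + G.degree v - 2 := by
    rw [← SimpleGraph.card_neighborFinset_eq_degree, hdu]
    have : G'.neighborFinset v = G.neighborFinset v ∪ S := by
      ext z
      rw [Finset.mem_union, SimpleGraph.mem_neighborFinset, SimpleGraph.mem_neighborFinset, hG']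
      constructor
      · rintro (h | h | h) <;> tauto
      · rintro (h | h)
        · left
          refine ⟨h, fun h => huv h.1.symm, fun h => hvT h.2⟩
        · tauto
    rw [this, Finset.card_union_of_disjoint, SimpleGraph.card_neighborFinset_eq_degree]
    · omega
    · rw [Finset.disjoint_right]
      intro z hz h
      exact hvS z hz (by simpa using h)
  have hdo : ∀ z, z ≠ u → z ≠ v → G'.degree z = G.degree z := by
    intro z hzu hzv
    rw [← SimpleGraph.card_neighborFinset_eq_degree, ← SimpleGraph.card_neighborFinset_eq_degree]
    by_cases hz : z ∈ S
    · have : G'.neighborFinset z = insert v ((G.neighborFinset z).erase u) := by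
        ext q
        rw [SimpleGraph.mem_neighborFinset, hG', Finset.mem_insert, Finset.mem_erase,
          SimpleGraph.mem_neighborFinset]
        tauto
      rw [this, Finset.card_insert_of_notMem, Finset.card_erase_add_one]
      · rw [SimpleGraph.mem_neighborFinset]
        exact ((hadj z).2 (by tauto)).symm
      · rw [Finset.mem_erase, SimpleGraph.mem_neighborFinset]
        exact fun h => hvS z hz h.2.symm
    · congr 1
      ext q
      rw [SimpleGraph.mem_neighborFinset, hG', SimpleGraph.mem_neighborFinset]
      tauto
  have hmono : ∀ z, z ≠ u → G.degree z ≤ G'.degree z := by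
    intro z hz
    by_cases hzv : z = v
    · subst hzv; omega
    · exact (hdo z hz hzv).ge
  -- edges
  set E : Finset (Sym2 V) := G.edgeFinset.filter (fun e => u ∉ e ∧ e ≠ s(w, v)) with hE
  have hEu : ∀ e ∈ E, u ∉ e := fun e he => (Finset.mem_filter.1 he).2.1
  have hEw : s(w, v) ∉ E := fun h => (Finset.mem_filter.1 h).2.2 rfl
  have hEv : ∀ z ∈ S, s(v, z) ∉ E := by
    intro z hz h
    exact hvS z hz (by simpa using (Finset.mem_filter.1 h).1)
  have hEm : ∀ p q, s(p, q) ∈ E ↔ G.Adj p q ∧ p ≠ u ∧ q ≠ u ∧ ¬ (p = w ∧ q = v) ∧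
      ¬ (p = v ∧ q = w) := by
    intro p q
    simp only [hE, Finset.mem_filter, SimpleGraph.mem_edgeFinset, SimpleGraph.mem_edgeSet,
      Sym2.mem_iff, Sym2.eq_iff, ne_eq, eq_comm (a := u), not_or, and_assoc]
  clear_value E
  have himg : ∀ a p q, s(p, q) ∈ S.image (fun z => s(a, z)) ↔
      (p = a ∧ q ∈ S) ∨ (q = a ∧ p ∈ S) := by
    intro a p q
    simp only [Finset.mem_image, Sym2.eq_iff]
    constructor
    · rintro ⟨z, hz, ⟨rfl, rfl⟩ | ⟨rfl, rfl⟩⟩ <;> tauto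
    · rintro (⟨rfl, h⟩ | ⟨rfl, h⟩)
      · exact ⟨q, h, by tauto⟩
      · exact ⟨p, h, by tauto⟩
  have hwv2 := hwv.symm
  have hGm : ∀ p q, G.Adj p q ↔ (p = u ∧ q = w ∨ p = w ∧ q = u) ∨
      (p = w ∧ q = v ∨ p = v ∧ q = w) ∨ (p = u ∧ q = y ∨ p = y ∧ q = u) ∨
      ((p = u ∧ q ∈ S) ∨ (q = u ∧ p ∈ S)) ∨ s(p, q) ∈ E := by
    intro p q
    rw [hEm]
    exact edge_aux1 (fun h => h ▸ hadj q) (fun h => h ▸ (G.adj_comm p u).trans (hadj p))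
      (fun h1 h2 => h1 ▸ h2 ▸ hwv) (fun h1 h2 => h1 ▸ h2 ▸ hwv2)
  have hGE : G.edgeFinset = insert s(u, w) (insert s(w, v) (insert s(u, y)
      (S.image (fun z => s(u, z)) ∪ E))) := by
    ext e
    induction e with | _ p q =>
    rw [SimpleGraph.mem_edgeFinset, SimpleGraph.mem_edgeSet, hGm]
    simp only [Finset.mem_insert, Finset.mem_union, himg, Sym2.eq_iff]
  have hGE' : G'.edgeFinset = insert s(u, w) (insert s(w, v) (insert s(u, y)
      (S.image (fun z => s(v, z)) ∪ E))) := by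
    ext e
    induction e with | _ p q =>
    rw [SimpleGraph.mem_edgeFinset, SimpleGraph.mem_edgeSet, hG']
    simp only [Finset.mem_insert, Finset.mem_union, himg, Sym2.eq_iff]
    have hpq : s(p, q) ∈ E → p ≠ u ∧ q ≠ u := by
      rw [hEm]; tauto
    rw [hGm]
    exact edge_aux2 huv hyu hwu huS hvT hyT hwT hpq
  have hsum : ∀ (a : V) (f : Sym2 V → ℝ), (∀ z ∈ S, s(a, z) ∉ E) → (a = u ∨ a = v) →
      ∑ e ∈ insert s(u, w) (insert s(w, v) (insert s(u, y)
      (S.image (fun z => s(a, z)) ∪ E))), f e = f s(u, w) + f s(w, v) + f s(u, y) + f s(a, x)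
        + (∑ z ∈ T, f s(a, z) + ∑ e ∈ E, f e) := by
    intro a f ha hav
    have haS : a ∉ S := by rcases hav with rfl | rfl <;> assumption
    have e1 : s(u, w) ∉ E := fun h => hEu _ h (by simp)
    have e2 : s(u, y) ∉ E := fun h => hEu _ h (by simp)
    have i1 : ∀ p q, p ∉ S → q ∉ S → s(p, q) ∉ S.image (fun z => s(a, z)) := by
      intro p q hp hq h
      rw [himg] at h
      tauto
    have hinj : Set.InjOn (fun z => s(a, z)) (S : Set V) := by
      intro p _ q _ h
      simp only [Sym2.eq_iff] at h
      rcases h with h | h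
      · exact h.2
      · exact h.2.trans h.1
    rw [Finset.sum_insert, Finset.sum_insert, Finset.sum_insert, Finset.sum_union,
      Finset.sum_image hinj, hsumS]
    · ring
    · rw [Finset.disjoint_left]
      intro e he
      obtain ⟨z, hz, rfl⟩ := Finset.mem_image.1 he
      exact ha z hz
    · simp [e2, -Finset.mem_image, i1 u y huS hyT]
    · rw [Finset.mem_insert, Finset.mem_union]
      rintro (h | h | h)
      · simp only [Sym2.eq_iff] at h; tauto
      · exact i1 _ _ hwT hvT h
      · exact hEw h
    · rw [Finset.mem_insert, Finset.mem_insert, Finset.mem_union]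
      rintro (h | h | h | h)
      · simp only [Sym2.eq_iff] at h; tauto
      · simp only [Sym2.eq_iff] at h; tauto
      · exact i1 _ _ huS hwT h
      · exact e1 h
  rw [sombor_eq_s15, sombor_eq_s15, hGE, hGE', hsum u _ (fun z hz h => hEu _ h (by simp)) (Or.inl rfl),
    hsum v _ hEv (Or.inr rfl)]
  have hxu : x ≠ u := fun h => huS (h ▸ hxS)
  have hxv : x ≠ v := fun h => hvT (h ▸ hxS)
  refine add_lt_add_of_lt_of_le ?_ (add_le_add ?_ ?_)
  · simp only [sfun_mk, hdu', hdv', hdo w hwu hwv', hdo y hyu hyv, hdo x hxu hxv, hdw]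
    have hx1 : 1 ≤ S.card := Finset.card_pos.2 ⟨x, hxS⟩
    exact_mod_cast final_ineq (by omega) hduv hyx
  · apply Finset.sum_le_sum
    intro z hz
    have hzS : z ∈ S := hTS z hz
    have hzu : z ≠ u := fun h => huS (h ▸ hzS)
    simp only [sfun_mk]
    apply sqrt_mono' (by positivity) (by positivity)
    · have : G.degree u ≤ G'.degree v := by omega
      exact_mod_cast this
    · exact_mod_cast hmono z hzu
  · apply Finset.sum_le_sum
    intro e he
    have := hEu e he
    induction e with | _ p q =>
    simp only [Sym2.mem_iff, not_or] at this
    simp only [sfun_mk]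
    apply sqrt_mono' (by positivity) (by positivity)
    · exact_mod_cast hmono p (Ne.symm this.1)
    · exact_mod_cast hmono q (Ne.symm this.2)

theorem sombor_unicyclic_shift2_b {V : Type*} [Fintype V]
    (G : SimpleGraph V) [DecidableRel G.Adj] (hG : Unicyclic G)
    (u x y w v : V) (c : G.Walk u u) (hc : c.IsCycle)
    (hx : s(u, x) ∈ c.edges) (hy : s(u, y) ∈ c.edges) (hxy : x ≠ y)
    (hyx : G.degree x ≤ G.degree y)
    (hw : w ∉ c.support) (hv : v ∉ c.support)
    (huw : G.Adj u w) (hwv : G.Adj w v) (hdw : G.degree w = 2) (hdv3 : 3 ≤ G.degree v)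
    (honly : ∀ z : V, (G.deleteEdges {s(u, w)}).Reachable v z → 3 ≤ G.degree z → z = v)
    (n m : ℕ)
    (U : Fin n → V) (hUinj : Function.Injective U)
    (hU : G.neighborSet u = {x, y, w} ∪ Set.range U) (hdu : G.degree u = n + 3)
    (W : Fin m → V) (hWinj : Function.Injective W)
    (hW : G.neighborSet v = {w} ∪ Set.range W) (hdv : G.degree v = m + 1)
    (hduv : G.degree u < G.degree v)
    (G' : SimpleGraph V)
    (hG' : G'.edgeSet =
      (G.edgeSet \ ({e | ∃ i : Fin n, e = s(u, U i)} ∪ {s(u, x)})) ∪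
        ({e | ∃ i : Fin n, e = s(v, U i)} ∪ {s(v, x)})) :
    somborIndex G < somborIndex G' := by
  classical
  have hbr := off_cycle_bridge G hG u x w c hc hx hw huw
  have hxc : x ∈ c.support := c.snd_mem_support_of_mem_edges hx
  have hyc : y ∈ c.support := c.snd_mem_support_of_mem_edges hy
  have huc : u ∈ c.support := c.start_mem_support
  have hux : G.Adj u x := c.adj_of_mem_edges hx
  have huv : u ≠ v := fun h => hv (h ▸ huc)
  have hyw : y ≠ w := fun h => hw (h ▸ hyc)
  have hxw : x ≠ w := fun h => hw (h ▸ hxc)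
  set T : Finset V := Finset.univ.image U with hT
  have hTm : ∀ z, z ∈ T ↔ ∃ i, U i = z := by simp [hT]
  have hTc : T.card = n := by
    rw [hT, Finset.card_image_of_injective _ hUinj]; simp
  have hN : G.neighborFinset u = insert y (insert w (insert x T)) := by
    ext z
    rw [SimpleGraph.mem_neighborFinset, ← SimpleGraph.mem_neighborSet, hU]
    simp only [Set.mem_union, Set.mem_insert_iff, Set.mem_singleton_iff, Set.mem_range,
      Finset.mem_insert, hTm]
    tauto
  have hcard : (insert y (insert w (insert x T))).card = T.card + 3 := by
    rw [← hN, SimpleGraph.card_neighborFinset_eq_degree, hdu, hTc]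
  have hxT : x ∉ T := by
    intro h
    rw [Finset.insert_eq_of_mem h] at hcard
    have h1 := Finset.card_insert_le y (insert w T)
    have h2 := Finset.card_insert_le w T
    omega
  have hwT : w ∉ insert x T := by
    intro h
    rw [Finset.insert_eq_of_mem h] at hcard
    have h1 := Finset.card_insert_le y (insert x T)
    have h2 := Finset.card_insert_le x T
    omega
  have hyT : y ∉ insert x T := by
    intro h
    rw [Finset.insert_eq_of_mem (Finset.mem_insert_of_mem h)] at hcard
    have h1 := Finset.card_insert_le w (insert x T)
    have h2 := Finset.card_insert_le x T
    omega
  have hadjS : ∀ z ∈ insert x T, G.Adj u z := by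
    intro z hz
    rw [← SimpleGraph.mem_neighborFinset, hN]
    simp only [Finset.mem_insert] at hz ⊢
    tauto
  have hadj' : ∀ p q, G'.Adj p q ↔
      (G.Adj p q ∧ ¬ (p = u ∧ q ∈ insert x T) ∧ ¬ (q = u ∧ p ∈ insert x T)) ∨
      (p = v ∧ q ∈ insert x T) ∨ (q = v ∧ p ∈ insert x T) := by
    intro p q
    rw [← SimpleGraph.mem_edgeSet, hG']
    simp only [Set.mem_union, Set.mem_sdiff, Set.mem_ofPred_eq, Set.mem_singleton_iff,
      SimpleGraph.mem_edgeSet, Finset.mem_insert, Sym2.eq_iff]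
    have key : ∀ a, (∃ i, p = a ∧ q = U i ∨ p = U i ∧ q = a) ↔
        (p = a ∧ q ∈ T) ∨ (q = a ∧ p ∈ T) := by
      intro a
      rw [hTm, hTm]
      constructor
      · rintro ⟨i, ⟨h1, h2⟩ | ⟨h1, h2⟩⟩
        · exact Or.inl ⟨h1, i, h2.symm⟩
        · exact Or.inr ⟨h2, i, h1.symm⟩
      · rintro (⟨h, i, h2⟩ | ⟨h, i, h2⟩)
        · exact ⟨i, Or.inl ⟨h, h2.symm⟩⟩
        · exact ⟨i, Or.inr ⟨h2.symm, h⟩⟩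
    rw [key, key, prop_aux, prop_aux, not_or]
  have hvT : v ∉ insert x T := by
    intro h
    exact G'.irrefl ((hadj' v v).2 (by tauto))
  have hvS : ∀ z ∈ insert x T, ¬ G.Adj v z := by
    intro z hz hvz
    apply hbr
    have hzw : z ≠ w := fun h => hwT (h ▸ hz)
    have a1 : (G.deleteEdges {s(u, w)}).Adj u z := by
      rw [SimpleGraph.deleteEdges_adj]
      refine ⟨hadjS z hz, ?_⟩
      have := huw.ne
      simp only [Set.mem_singleton_iff, Sym2.eq_iff]
      tauto
    have a2 : (G.deleteEdges {s(u, w)}).Adj z v := by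
      rw [SimpleGraph.deleteEdges_adj]
      refine ⟨hvz.symm, ?_⟩
      have := hwv.ne
      simp only [Set.mem_singleton_iff, Sym2.eq_iff]
      tauto
    have a3 : (G.deleteEdges {s(u, w)}).Adj v w := by
      rw [SimpleGraph.deleteEdges_adj]
      refine ⟨hwv.symm, ?_⟩
      have := hwv.ne
      simp only [Set.mem_singleton_iff, Sym2.eq_iff]
      tauto
    exact a1.reachable.trans (a2.reachable.trans a3.reachable)
  exact sombor_core_s15 G G' u x y w v T hyx huv hwv (fun h => hv (h ▸ hyc)) hdw hxT hyT hwT hyw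
    hvT hN hvS hduv hadj'
end
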